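/- arXiv:2412.10875 — 6 statements merged into one kernel-verified Lean document; each statement's English description precedes it below -/
import Mathlib

section
/- Let (X, 𝒜, μ) be a measure space and let ρ_n, ρ, m_n, m : X → ℝ be measurable with ρ_n ≥ 0 and ρ ≥ 0. Define u_n = m_n/ρ_n on {ρ_n > 0} and u_n = 0 on {ρ_n = 0}, and u = m/ρ on {ρ > 0} and u = 0 on {ρ = 0}. Assume ρ_n → ρ μ-almost everywhere and m_n → m μ-almost everywhere, and let f : ℝ → ℝ be continuous and bounded. Then ρ_n · f(u_n) → ρ · f(u) μ-almost everywhere on X. -/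
open Filter Topology MeasureTheory

/-- with velocities reconstructed as u = m/ρ on {ρ>0}, 0 on {ρ=0},
a.e. convergence ρ_n → ρ, m_n → m implies ρ_n f(u_n) → ρ f(u) a.e. for f
continuous and bounded. -/
theorem stmt_7 {X : Type*} [MeasurableSpace X] (μ : Measure X)
    (ρn mn : ℕ → X → ℝ) (ρ m : X → ℝ)
    (hρnmeas : ∀ n, Measurable (ρn n)) (hmnmeas : ∀ n, Measurable (mn n))
    (hρmeas : Measurable ρ) (hmmeas : Measurable m)
    (hρnpos : ∀ n x, 0 ≤ ρn n x) (hρpos : ∀ x, 0 ≤ ρ x)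
    (un : ℕ → X → ℝ) (u : X → ℝ)
    (hun : ∀ n x, un n x = if 0 < ρn n x then mn n x / ρn n x else 0)
    (hu : ∀ x, u x = if 0 < ρ x then m x / ρ x else 0)
    (hρconv : ∀ᵐ x ∂μ, Tendsto (fun n => ρn n x) atTop (𝓝 (ρ x)))
    (hmconv : ∀ᵐ x ∂μ, Tendsto (fun n => mn n x) atTop (𝓝 (m x)))
    (f : ℝ → ℝ) (hf : Continuous f) (hfb : ∃ C, ∀ t, |f t| ≤ C) :
    ∀ᵐ x ∂μ, Tendsto (fun n => ρn n x * f (un n x)) atTop (𝓝 (ρ x * f (u x))) := by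
  obtain ⟨C, hC⟩ := hfb
  filter_upwards [hρconv, hmconv] with x hρx hmx
  rcases (hρpos x).eq_or_lt with h0 | hpos
  · rw [← h0] at hρx ⊢
    rw [zero_mul]
    refine squeeze_zero_norm (a := fun n => ρn n x * C) (fun n => ?_) ?_
    · rw [Real.norm_eq_abs, abs_mul, abs_of_nonneg (hρnpos n x)]
      exact mul_le_mul_of_nonneg_left (hC _) (hρnpos n x)
    · simpa using hρx.mul_const C
  · refine hρx.mul ((hf.tendsto _).comp ?_)
    rw [hu, if_pos hpos]
    refine (hmx.div hρx hpos.ne').congr' ?_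
    filter_upwards [hρx.eventually_const_lt hpos] with n hn
    simp [hun, hn]
end

section
/- Let (X, 𝒜, μ) be a measure space and let ρ_n, ρ, m_n, m : X → ℝ be measurable with ρ_n ≥ 0 and ρ ≥ 0. Define u_n = m_n/ρ_n on {ρ_n > 0} and u_n = 0 on {ρ_n = 0}, and u = m/ρ on {ρ > 0} and u = 0 on {ρ = 0}. Assume ρ_n → ρ μ-almost everywhere, m_n → m μ-almost everywhere, and m = 0 μ-almost everywhere on the set {ρ = 0}. Let f : ℝ → ℝ be continuous and bounded. Then ρ_n · u_n · f(u_n) → ρ · u · f(u) μ-almost everywhere on X. -/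
open Filter Topology MeasureTheory

/-- with velocities reconstructed as u = m/ρ on {ρ>0}, 0 on {ρ=0},
a.e. convergence ρ_n → ρ, m_n → m, together with m = 0 a.e. on {ρ=0}, implies
ρ_n u_n f(u_n) → ρ u f(u) a.e. for f continuous and bounded. -/
theorem stmt_8 {X : Type*} [MeasurableSpace X] (μ : Measure X)
    (ρn mn : ℕ → X → ℝ) (ρ m : X → ℝ)
    (hρnmeas : ∀ n, Measurable (ρn n)) (hmnmeas : ∀ n, Measurable (mn n))
    (hρmeas : Measurable ρ) (hmmeas : Measurable m)
    (hρnpos : ∀ n x, 0 ≤ ρn n x) (hρpos : ∀ x, 0 ≤ ρ x)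
    (un : ℕ → X → ℝ) (u : X → ℝ)
    (hun : ∀ n x, un n x = if 0 < ρn n x then mn n x / ρn n x else 0)
    (hu : ∀ x, u x = if 0 < ρ x then m x / ρ x else 0)
    (hρconv : ∀ᵐ x ∂μ, Tendsto (fun n => ρn n x) atTop (𝓝 (ρ x)))
    (hmconv : ∀ᵐ x ∂μ, Tendsto (fun n => mn n x) atTop (𝓝 (m x)))
    (hm0 : ∀ᵐ x ∂μ, ρ x = 0 → m x = 0)
    (f : ℝ → ℝ) (hf : Continuous f) (hfb : ∃ C, ∀ t, |f t| ≤ C) :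
    ∀ᵐ x ∂μ,
      Tendsto (fun n => ρn n x * un n x * f (un n x)) atTop
        (𝓝 (ρ x * u x * f (u x))) := by
  obtain ⟨C, hC⟩ := hfb
  have hun' : ∀ n x, un n x = mn n x / ρn n x := fun n x => by
    rw [hun]
    split_ifs with h
    · rfl
    · rw [le_antisymm (not_lt.mp h) (hρnpos n x), div_zero]
  filter_upwards [hρconv, hmconv, hm0] with x hρx hmx h0
  rcases (hρpos x).eq_or_lt with h | h
  · have hm : Tendsto (fun n => |mn n x| * C) atTop (𝓝 0) := by
      simpa [h0 h.symm] using hmx.abs.mul_const C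
    rw [← h, zero_mul, zero_mul]
    refine squeeze_zero_norm (fun n => ?_) hm
    rw [Real.norm_eq_abs, abs_mul]
    refine mul_le_mul ?_ (hC _) (abs_nonneg _) (abs_nonneg _)
    rcases eq_or_ne (ρn n x) 0 with h' | h'
    · simp [h']
    · rw [hun', mul_div_cancel₀ _ h']
  · have hux : Tendsto (fun n => un n x) atTop (𝓝 (u x)) := by
      simp only [hun', hu, if_pos h]
      exact hmx.div hρx h.ne'
    exact (hρx.mul hux).mul ((hf.tendsto _).comp hux)
end

section
/- Let (X, 𝒜, μ) be a measure space and let ρ_n, ρ, m_n, m, g_n, g : X → ℝ be measurable with ρ_n ≥ 0 and ρ ≥ 0. Define u_n = m_n/ρ_n on {ρ_n > 0} and u_n = 0 on {ρ_n = 0}, and u = m/ρ on {ρ > 0} and u = 0 on {ρ = 0}. Assume ρ_n → ρ μ-almost everywhere, m_n → m μ-almost everywhere, g_n → g μ-almost everywhere, and g = 0 μ-almost everywhere on the set {ρ = 0}. Let f : ℝ → ℝ be continuous and bounded. Then g_n · f(u_n) → g · f(u) μ-almost everywhere on X. -/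
open Filter Topology MeasureTheory

/-- with velocities reconstructed as u = m/ρ on {ρ>0}, 0 on {ρ=0},
a.e. convergences ρ_n → ρ, m_n → m, g_n → g, together with g = 0 a.e. on {ρ=0},
imply g_n f(u_n) → g f(u) a.e. for f continuous and bounded. -/
theorem stmt_9 {X : Type*} [MeasurableSpace X] (μ : Measure X)
    (ρn mn gn : ℕ → X → ℝ) (ρ m g : X → ℝ)
    (hρnmeas : ∀ n, Measurable (ρn n)) (hmnmeas : ∀ n, Measurable (mn n))
    (hgnmeas : ∀ n, Measurable (gn n))
    (hρmeas : Measurable ρ) (hmmeas : Measurable m) (hgmeas : Measurable g)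
    (hρnpos : ∀ n x, 0 ≤ ρn n x) (hρpos : ∀ x, 0 ≤ ρ x)
    (un : ℕ → X → ℝ) (u : X → ℝ)
    (hun : ∀ n x, un n x = if 0 < ρn n x then mn n x / ρn n x else 0)
    (hu : ∀ x, u x = if 0 < ρ x then m x / ρ x else 0)
    (hρconv : ∀ᵐ x ∂μ, Tendsto (fun n => ρn n x) atTop (𝓝 (ρ x)))
    (hmconv : ∀ᵐ x ∂μ, Tendsto (fun n => mn n x) atTop (𝓝 (m x)))
    (hgconv : ∀ᵐ x ∂μ, Tendsto (fun n => gn n x) atTop (𝓝 (g x)))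
    (hg0 : ∀ᵐ x ∂μ, ρ x = 0 → g x = 0)
    (f : ℝ → ℝ) (hf : Continuous f) (hfb : ∃ C, ∀ t, |f t| ≤ C) :
    ∀ᵐ x ∂μ, Tendsto (fun n => gn n x * f (un n x)) atTop (𝓝 (g x * f (u x))) := by
  obtain ⟨C, hC⟩ := hfb
  filter_upwards [hρconv, hmconv, hgconv, hg0] with x hρx hmx hgx hg0x
  rcases (hρpos x).eq_or_lt with h0 | hpos
  · rw [hg0x h0.symm] at hgx ⊢
    rw [zero_mul]
    have hbound : Tendsto (fun n => |gn n x| * C) atTop (𝓝 0) := by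
      simpa using hgx.abs.mul_const C
    refine squeeze_zero_norm (fun n => ?_) hbound
    rw [Real.norm_eq_abs, abs_mul]
    exact mul_le_mul_of_nonneg_left (hC _) (abs_nonneg _)
  · have hu_tendsto : Tendsto (fun n => un n x) atTop (𝓝 (u x)) := by
      rw [hu, if_pos hpos]
      refine (hmx.div hρx hpos.ne').congr' ?_
      filter_upwards [hρx.eventually_const_lt hpos] with n hn
      simp [hun, hn]
    exact hgx.mul ((hf.tendsto _).comp hu_tendsto)
end

section
/- Let (X, 𝒜, μ) be a measure space and let ρ_n, ρ, m_n, m : X → ℝ be measurable with ρ_n > 0 μ-almost everywhere and ρ ≥ 0. Assume ρ_n → ρ μ-almost everywhere, m_n → m μ-almost everywhere, and liminf_{n→∞} ∫_X m_n² / ρ_n dμ < ∞. Then m = 0 μ-almost everywhere on the set {ρ = 0}. -/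
open Filter Topology MeasureTheory

/-- if ρ_n > 0 a.e., ρ_n → ρ and m_n → m a.e., and
liminf_n ∫ m_n²/ρ_n dμ < ∞, then m = 0 a.e. on the vacuum set {ρ = 0}. -/
theorem stmt_10 {X : Type*} [MeasurableSpace X] (μ : Measure X)
    (ρn mn : ℕ → X → ℝ) (ρ m : X → ℝ)
    (hρnmeas : ∀ n, Measurable (ρn n)) (hmnmeas : ∀ n, Measurable (mn n))
    (hρmeas : Measurable ρ) (hmmeas : Measurable m)
    (hρnpos : ∀ n, ∀ᵐ x ∂μ, 0 < ρn n x) (hρpos : ∀ x, 0 ≤ ρ x)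
    (hρconv : ∀ᵐ x ∂μ, Tendsto (fun n => ρn n x) atTop (𝓝 (ρ x)))
    (hmconv : ∀ᵐ x ∂μ, Tendsto (fun n => mn n x) atTop (𝓝 (m x)))
    (hliminf :
      Filter.liminf (fun n => ∫⁻ x, ENNReal.ofReal (mn n x ^ 2 / ρn n x) ∂μ) atTop < ⊤) :
    ∀ᵐ x ∂μ, ρ x = 0 → m x = 0 := by
  have hmeas : ∀ n, Measurable fun x => ENNReal.ofReal (mn n x ^ 2 / ρn n x) := fun n =>
    (((hmnmeas n).pow_const 2).div (hρnmeas n)).ennreal_ofReal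
  have hfin : ∀ᵐ x ∂μ,
      liminf (fun n => ENNReal.ofReal (mn n x ^ 2 / ρn n x)) atTop < ⊤ :=
    ae_lt_top (Measurable.liminf hmeas) ((lintegral_liminf_le hmeas).trans_lt hliminf).ne
  filter_upwards [hfin, ae_all_iff.2 hρnpos, hρconv, hmconv] with x hx hpos hρ hm hρ0
  by_contra hm0
  rw [hρ0] at hρ
  have hinv : Tendsto (fun n => (ρn n x)⁻¹) atTop atTop :=
    (tendsto_nhdsWithin_iff.2 ⟨hρ, Eventually.of_forall hpos⟩).inv_tendsto_nhdsGT_zero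
  have htop : Tendsto (fun n => mn n x ^ 2 / ρn n x) atTop atTop := by
    simpa only [div_eq_mul_inv] using (hm.pow 2).pos_mul_atTop (by positivity) hinv
  exact hx.ne (ENNReal.tendsto_ofReal_atTop.comp htop).liminf_eq
end

section
/- Let T > 0, let α ∈ ℝ, and let ρ, u : ℝ × (0,T) → ℝ be smooth, with ρ(x,t) > 0 for all (x,t), satisfying the continuity equation ∂_t ρ + ∂_x(ρ u) = 0 everywhere. Define Q(x,t) = ρ(x,t)^{α−2} ∂_x ρ(x,t). Then at every point, ∂_t Q + u ∂_x Q = − ρ^{−1} ∂_x( ρ^α ∂_x u ). -/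
theorem hasDerivAt_slice_fst {F : ℝ × ℝ → ℝ} (hF : Differentiable ℝ F) (x t : ℝ) :
    HasDerivAt (fun y => F (y, t)) (fderiv ℝ F (x, t) (1, 0)) x :=
  (hF (x, t)).hasFDerivAt.comp_hasDerivAt x ((hasDerivAt_id x).prodMk (hasDerivAt_const x t))

theorem hasDerivAt_slice_snd {F : ℝ × ℝ → ℝ} (hF : Differentiable ℝ F) (x t : ℝ) :
    HasDerivAt (fun s => F (x, s)) (fderiv ℝ F (x, t) (0, 1)) t :=
  (hF (x, t)).hasFDerivAt.comp_hasDerivAt t ((hasDerivAt_const t x).prodMk (hasDerivAt_id t))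

theorem differentiable_fderiv_apply {F : ℝ × ℝ → ℝ} (hF : ContDiff ℝ 2 F) (v : ℝ × ℝ) :
    Differentiable ℝ (fun p => fderiv ℝ F p v) :=
  ((hF.fderiv_right (m := 1) (by norm_num)).differentiable (by norm_num)).clm_apply
    (differentiable_const v)

theorem fderiv_fderiv_apply_comm {F : ℝ × ℝ → ℝ} (hF : ContDiff ℝ 2 F) (p v w : ℝ × ℝ) :
    fderiv ℝ (fun q => fderiv ℝ F q v) p w = fderiv ℝ (fun q => fderiv ℝ F q w) p v := by
  have hd : DifferentiableAt ℝ (fderiv ℝ F) p :=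
    ((hF.fderiv_right (m := 1) (by norm_num)).differentiable (by norm_num)) p
  have key (a b : ℝ × ℝ) :
      fderiv ℝ (fun q => fderiv ℝ F q a) p b = fderiv ℝ (fderiv ℝ F) p b a := by
    rw [fderiv_clm_apply hd (differentiableAt_const a)]
    simp
  rw [key, key]
  exact (hF.contDiffAt.isSymmSndFDerivAt (by simp)) w v


/-- for smooth positive solutions of the continuity equation on
ℝ × (0,T), the drift Q = ρ^(α−2) ∂_x ρ satisfies the transport equation
∂_t Q + u ∂_x Q = −ρ⁻¹ ∂_x(ρ^α ∂_x u). -/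
theorem stmt_12 (T : ℝ) (hT : 0 < T) (α : ℝ) (ρ u : ℝ → ℝ → ℝ)
    (hρ : ContDiff ℝ (⊤ : ℕ∞) (fun p : ℝ × ℝ => ρ p.1 p.2))
    (hu : ContDiff ℝ (⊤ : ℕ∞) (fun p : ℝ × ℝ => u p.1 p.2))
    (hpos : ∀ x t, 0 < ρ x t)
    (hcont : ∀ (x : ℝ), ∀ t ∈ Set.Ioo 0 T,
      deriv (fun s => ρ x s) t + deriv (fun y => ρ y t * u y t) x = 0)
    (Q : ℝ → ℝ → ℝ)
    (hQ : ∀ x t, Q x t = ρ x t ^ (α - 2) * deriv (fun y => ρ y t) x) :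
    ∀ (x : ℝ), ∀ t ∈ Set.Ioo 0 T,
      deriv (fun s => Q x s) t + u x t * deriv (fun y => Q y t) x =
        -(ρ x t)⁻¹ * deriv (fun y => ρ y t ^ α * deriv (fun z => u z t) y) x := by
  intro x t ht
  set R : ℝ × ℝ → ℝ := fun p => ρ p.1 p.2
  set U : ℝ × ℝ → ℝ := fun p => u p.1 p.2
  have hR2 : ContDiff ℝ 2 R := mod_cast contDiff_infty.1 hρ 2
  have hU2 : ContDiff ℝ 2 U := mod_cast contDiff_infty.1 hu 2
  have hRd : Differentiable ℝ R := hR2.differentiable (by norm_num)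
  have hUd : Differentiable ℝ U := hU2.differentiable (by norm_num)
  have ρx (y s : ℝ) : HasDerivAt (fun z => ρ z s) (fderiv ℝ R (y, s) (1, 0)) y :=
    hasDerivAt_slice_fst hRd y s
  have ρt (y s : ℝ) : HasDerivAt (fun r => ρ y r) (fderiv ℝ R (y, s) (0, 1)) s :=
    hasDerivAt_slice_snd hRd y s
  have ux (y s : ℝ) : HasDerivAt (fun z => u z s) (fderiv ℝ U (y, s) (1, 0)) y :=
    hasDerivAt_slice_fst hUd y s
  have ρxx := hasDerivAt_slice_fst (differentiable_fderiv_apply hR2 (1, 0)) x t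
  have ρxt := hasDerivAt_slice_snd (differentiable_fderiv_apply hR2 (1, 0)) x t
  have ρtx := hasDerivAt_slice_fst (differentiable_fderiv_apply hR2 (0, 1)) x t
  have uxx := hasDerivAt_slice_fst (differentiable_fderiv_apply hU2 (1, 0)) x t
  have continuity_eq (y : ℝ) : fderiv ℝ R (y, t) (0, 1) =
      -(fderiv ℝ R (y, t) (1, 0) * u y t + ρ y t * fderiv ℝ U (y, t) (1, 0)) := by
    have h := hcont y t ht
    rw [(ρt y t).deriv, ((ρx y t).fun_mul (ux y t)).deriv] at h
    linarith
  have mixed := ρtx.unique <| (((ρxx.fun_mul (ux x t)).fun_add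
    ((ρx x t).fun_mul uxx)).fun_neg).congr_of_eventuallyEq (.of_forall continuity_eq)
  rw [fderiv_fderiv_apply_comm hR2] at mixed
  have hne := (hpos x t).ne'
  have Qt := ((ρt x t).rpow_const (p := α - 2) (.inl hne)).fun_mul ρxt
  have Qx := ((ρx x t).rpow_const (p := α - 2) (.inl hne)).fun_mul ρxx
  have flux := ((ρx x t).rpow_const (p := α) (.inl hne)).fun_mul uxx
  simp only [hQ, (ρx _ _).deriv, (ux _ _).deriv]
  rw [Qt.deriv, Qx.deriv, flux.deriv, mixed, continuity_eq x]
  have e1 : ρ x t ^ (α - 2) = ρ x t ^ (α - 2 - 1) * ρ x t := by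
    rw [← Real.rpow_add_one hne]; ring_nf
  have e2 : ρ x t ^ (α - 1) = ρ x t ^ (α - 2 - 1) * ρ x t ^ 2 := by
    rw [← Real.rpow_add_natCast hne]; push_cast; ring_nf
  have e3 : ρ x t ^ α = ρ x t ^ (α - 2 - 1) * ρ x t ^ 3 := by
    rw [← Real.rpow_add_natCast hne]; push_cast; ring_nf
  rw [e1, e2, e3]
  field_simp
  ring
end

section
/- Let α ∈ ℝ and let ρ, u : ℝ → ℝ be smooth with ρ(x) > 0 for all x. Define M = ρ^{α/2} ∂_x u + ρ^{(1−α)/2} ( ∂_xx √ρ − 4 (∂_x ρ^{1/4})² ). Then at every point, ∂_x( ρ^{α/2} M ) = ∂_x( ρ^α ∂_x u ) + ρ ∂_x( ∂_xx √ρ / √ρ ). -/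
/-- For a positive function `ρ` with differentiable square root,
`4 |∂ ρ^(1/4)|² = (∂ √ρ)² / √ρ`. -/
theorem four_mul_sq_deriv_rpow_quarter {ρ : ℝ → ℝ} {x : ℝ} (hpos : ∀ x, 0 < ρ x)
    (hs : DifferentiableAt ℝ (fun z => Real.sqrt (ρ z)) x) :
    4 * (deriv (fun z => ρ z ^ ((1 : ℝ) / 4)) x) ^ 2 =
      (deriv (fun z => Real.sqrt (ρ z)) x) ^ 2 / Real.sqrt (ρ x) := by
  have hsx : 0 < Real.sqrt (ρ x) := Real.sqrt_pos.2 (hpos x)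
  have hq : (fun z => ρ z ^ ((1 : ℝ) / 4)) = fun z => Real.sqrt (Real.sqrt (ρ z)) := by
    funext z
    rw [Real.sqrt_eq_rpow, Real.sqrt_eq_rpow, ← Real.rpow_mul (hpos z).le]
    norm_num
  rw [hq, (hs.hasDerivAt.sqrt hsx.ne').deriv, div_pow, mul_pow, Real.sq_sqrt hsx.le]
  field_simp
  ring

/-- The identity `∂(s ∂²s - (∂s)²) = s² ∂(∂²s / s)` for a thrice differentiable function. -/
theorem deriv_mul_deriv_deriv_sub_sq {s : ℝ → ℝ} {x : ℝ} (hx : s x ≠ 0)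
    (h0 : DifferentiableAt ℝ s x) (h1 : DifferentiableAt ℝ (deriv s) x)
    (h2 : DifferentiableAt ℝ (deriv (deriv s)) x) :
    deriv (fun y => s y * deriv (deriv s) y - deriv s y ^ 2) x =
      s x ^ 2 * deriv (fun y => deriv (deriv s) y / s y) x := by
  rw [((h0.hasDerivAt.fun_mul h2.hasDerivAt).fun_sub (h1.hasDerivAt.fun_pow 2)).deriv,
    (h2.hasDerivAt.fun_div h0.hasDerivAt hx).deriv]
  field_simp
  ring


/-- for smooth positive ρ, with
M = ρ^(α/2) ∂_x u + ρ^((1−α)/2)(∂_xx√ρ − 4 (∂_x ρ^(1/4))²), one has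
∂_x(ρ^(α/2) M) = ∂_x(ρ^α ∂_x u) + ρ ∂_x(∂_xx√ρ/√ρ). -/
theorem stmt_14 (α : ℝ) (ρ u : ℝ → ℝ)
    (hρ : ContDiff ℝ (⊤ : ℕ∞) ρ) (hu : ContDiff ℝ (⊤ : ℕ∞) u) (hpos : ∀ x, 0 < ρ x)
    (M : ℝ → ℝ)
    (hM : ∀ x, M x =
      ρ x ^ (α / 2) * deriv u x +
        ρ x ^ ((1 - α) / 2) *
          (deriv (deriv (fun z => Real.sqrt (ρ z))) x -
            4 * (deriv (fun z => ρ z ^ ((1 : ℝ) / 4)) x) ^ 2)) :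
    ∀ x : ℝ,
      deriv (fun y => ρ y ^ (α / 2) * M y) x =
        deriv (fun y => ρ y ^ α * deriv u y) x +
          ρ x * deriv (fun y =>
            deriv (deriv (fun z => Real.sqrt (ρ z))) y / Real.sqrt (ρ y)) x := by
  intro x
  have hs : ContDiff ℝ (⊤ : ℕ∞) (fun z => Real.sqrt (ρ z)) := hρ.sqrt fun z => (hpos z).ne'
  have hs1 : ContDiff ℝ (⊤ : ℕ∞) (deriv fun z => Real.sqrt (ρ z)) :=
    (contDiff_infty_iff_deriv.1 hs).2
  have hs2 : ContDiff ℝ (⊤ : ℕ∞) (deriv (deriv fun z => Real.sqrt (ρ z))) :=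
    (contDiff_infty_iff_deriv.1 hs1).2
  have hu1 : ContDiff ℝ (⊤ : ℕ∞) (deriv u) := (contDiff_infty_iff_deriv.1 hu).2
  have diff {f : ℝ → ℝ} (hf : ContDiff ℝ (⊤ : ℕ∞) f) (y : ℝ) : DifferentiableAt ℝ f y :=
    hf.differentiable (by simp) y
  have key : (fun y => ρ y ^ (α / 2) * M y) = fun y => ρ y ^ α * deriv u y +
      (Real.sqrt (ρ y) * deriv (deriv fun z => Real.sqrt (ρ z)) y -
        (deriv (fun z => Real.sqrt (ρ z)) y) ^ 2) := by
    funext y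
    have hsy : Real.sqrt (ρ y) ≠ 0 := (Real.sqrt_pos.2 (hpos y)).ne'
    have e1 : ρ y ^ (α / 2) * ρ y ^ (α / 2) = ρ y ^ α := by
      rw [← Real.rpow_add (hpos y), add_halves]
    have e2 : ρ y ^ (α / 2) * ρ y ^ ((1 - α) / 2) = Real.sqrt (ρ y) := by
      rw [← Real.rpow_add (hpos y), Real.sqrt_eq_rpow]
      ring_nf
    rw [hM, four_mul_sq_deriv_rpow_quarter hpos (diff hs y), mul_add, ← mul_assoc, ← mul_assoc,
      e1, e2, mul_sub, mul_div_cancel₀ _ hsy]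
  have hv : DifferentiableAt ℝ (fun y => ρ y ^ α * deriv u y) x :=
    ((diff hρ x).rpow_const (Or.inl (hpos x).ne')).fun_mul (diff hu1 x)
  have hc : DifferentiableAt ℝ (fun y =>
      Real.sqrt (ρ y) * deriv (deriv fun z => Real.sqrt (ρ z)) y -
        (deriv (fun z => Real.sqrt (ρ z)) y) ^ 2) x :=
    ((diff hs x).fun_mul (diff hs2 x)).fun_sub ((diff hs1 x).fun_pow 2)
  rw [key, deriv_fun_add hv hc, deriv_mul_deriv_deriv_sub_sq (s := fun z => Real.sqrt (ρ z))
    (Real.sqrt_pos.2 (hpos x)).ne' (diff hs x) (diff hs1 x) (diff hs2 x), Real.sq_sqrt (hpos x).le]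
end
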